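/- If a virtual mosaic injection ι_{ij} is applied to a virtual n-mosaic V (inserting two rows and two columns of tiles as in the standard injection, with the new boundary edges labeled in adjacent pairs), then the genus of the resulting virtual (n+2)-mosaic equals the genus of V. -/

import Mathlib

/-- Insert a pair of adjacent points, matched to each other, at position `k` of a
matching `M` on `m` cyclically ordered points. -/
def insertPair (m k : ℕ) (hk : k ≤ m) (M : Fin m → Fin m) :
    Fin (m + 2) → Fin (m + 2) := fun y =>
  if h1 : y.val = k then ⟨k + 1, by omega⟩
  else if h2 : y.val = k + 1 then ⟨k, by omega⟩
  else if h3 : y.val < k then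
    let x := M ⟨y.val, by omega⟩
    if hx : x.val < k then ⟨x.val, by omega⟩
    else ⟨x.val + 2, by have := x.isLt; omega⟩
  else
    let x := M ⟨y.val - 2, by have := y.isLt; omega⟩
    if hx : x.val < k then ⟨x.val, by omega⟩
    else ⟨x.val + 2, by have := x.isLt; omega⟩

/-- The genus of the closed orientable surface obtained by gluing a polygon with
`m` boundary edges according to the matching `M`: the vertex classes `V` are the
orbits of (rotation ∘ matching), and 2g = m/2 + 1 - V. -/
def matchingGenus (m : ℕ) (M : Fin m → Fin m) (hM : Function.Involutive M) : ℕ :=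
  let τ : Equiv.Perm (Fin m) := (Function.Involutive.toPerm M hM).trans (finRotate m)
  let V : ℕ := (Finset.univ.filter fun x : Fin m => τ x = x).card + τ.cycleType.card
  (m / 2 + 1 - V) / 2

open Equiv Equiv.Perm in
/-- Splitting a non-fixed point off its cycle creates exactly one new cycle. -/
theorem card_fixed_add_card_cycleType_swap_mul {α : Type*} [Fintype α] [DecidableEq α]
    (f : Equiv.Perm α) (x : α) (hx : f x ≠ x) :
    (Finset.univ.filter fun y => (swap x (f x) * f) y = y).card
        + (swap x (f x) * f).cycleType.card
      = (Finset.univ.filter fun y => f y = y).card + f.cycleType.card + 1 := by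
  have card_fixed (g : Equiv.Perm α) :
      (Finset.univ.filter fun y => g y = y).card + g.support.card = Fintype.card α := by
    simpa [Equiv.Perm.support] using
      Finset.card_filter_add_card_filter_not (s := Finset.univ) (fun y => g y = y)
  set c := f.cycleOf x with hc
  have hcx : c x = f x := cycleOf_apply_self f x
  have hcyc : c.IsCycle := isCycle_cycleOf f hx
  set r := c⁻¹ * f with hr
  have hf : f = c * r := by simp [hr]
  have hdisj : c.Disjoint r := by
    rw [hr]
    have h := disjoint_mul_inv_of_mem_cycleFactorsFinset
      (cycleOf_mem_cycleFactorsFinset_iff.2 (mem_support.2 hx))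
    have hcomm : Commute c f := self_mem_cycle_factors_commute
      (cycleOf_mem_cycleFactorsFinset_iff.2 (mem_support.2 hx))
    rw [(hcomm.inv_left).eq]
    exact h.symm
  have hmul : swap x (f x) * f = (swap x (c x) * c) * r := by
    rw [mul_assoc, ← hf, hcx]
  have key : (swap x (c x) * c).Disjoint r ∧
      (swap x (c x) * c).cycleType.card + c.support.card
        = c.cycleType.card + (swap x (c x) * c).support.card + 1 := by
    by_cases h2 : c (c x) = x
    · have hsw : c = swap x (c x) := hcyc.eq_swap_of_apply_apply_eq_self (by rwa [hcx]) h2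
      have h1 : swap x (c x) * c = 1 := by
        nth_rw 2 [hsw]
        exact swap_mul_self _ _
      have hs : c.support.card = 2 := by
        rw [hsw]
        exact card_support_swap (by rw [hcx]; exact hx.symm)
      rw [h1]
      refine ⟨disjoint_one_left r, ?_⟩
      simp [hs, hcyc.cycleType]
    · have hsup := support_swap_mul_eq c x h2
      have hcyc' := hcyc.swap_mul (by rwa [hcx]) h2
      have hmem : x ∈ c.support := by rw [mem_support, hcx]; exact hx
      constructor
      · rw [disjoint_iff_disjoint_support, hsup]
        exact (disjoint_iff_disjoint_support.1 hdisj).mono_left Finset.sdiff_subset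
      · rw [hcyc'.cycleType, hcyc.cycleType, hsup, Finset.sdiff_singleton_eq_erase,
          Finset.card_erase_of_mem hmem]
        have := Finset.card_pos.2 ⟨x, hmem⟩
        simp only [Multiset.card_singleton]
        omega
  obtain ⟨hdisj', hcount⟩ := key
  have e1 := card_fixed f
  have e2 := card_fixed (swap x (f x) * f)
  have e3 : f.support.card = c.support.card + r.support.card := by
    conv_lhs => rw [hf]
    exact hdisj.card_support_mul
  have e4 : (swap x (f x) * f).support.card
      = (swap x (c x) * c).support.card + r.support.card := by
    rw [hmul]
    exact hdisj'.card_support_mul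
  have e5 : f.cycleType.card = c.cycleType.card + r.cycleType.card := by
    conv_lhs => rw [hf]
    rw [hdisj.cycleType_mul, Multiset.card_add]
  have e6 : (swap x (f x) * f).cycleType.card
      = (swap x (c x) * c).cycleType.card + r.cycleType.card := by
    rw [hmul, hdisj'.cycleType_mul, Multiset.card_add]
  omega

open Equiv Equiv.Perm in
theorem card_fixed_add_card_cycleType_extendDomain {α β : Type*} [Fintype α] [DecidableEq α]
    [Fintype β] [DecidableEq β] {p : β → Prop} [DecidablePred p] (g : Equiv.Perm α)
    (f : α ≃ Subtype p) :
    (Finset.univ.filter fun y => g.extendDomain f y = y).card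
        + (g.extendDomain f).cycleType.card + Fintype.card α
      = (Finset.univ.filter fun y => g y = y).card + g.cycleType.card + Fintype.card β := by
  have e1 : (Finset.univ.filter fun y => g y = y).card + g.support.card = Fintype.card α := by
    simpa [Equiv.Perm.support] using
      Finset.card_filter_add_card_filter_not (s := Finset.univ) (fun y => g y = y)
  have e2 : (Finset.univ.filter fun y => g.extendDomain f y = y).card
      + (g.extendDomain f).support.card = Fintype.card β := by
    simpa [Equiv.Perm.support] using
      Finset.card_filter_add_card_filter_not (s := Finset.univ) (fun y => g.extendDomain f y = y)
  have e3 : (g.extendDomain f).support.card = g.support.card := card_support_extend_domain f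
  have e4 : (g.extendDomain f).cycleType = g.cycleType := cycleType_extendDomain f
  rw [e4]
  omega

/-- The embedding of the old boundary points that skips positions `k` and `k + 1`. -/
def skipPair (m k : ℕ) (x : Fin m) : Fin (m + 2) :=
  if x.val < k then ⟨x.val, by omega⟩ else ⟨x.val + 2, by omega⟩

theorem val_skipPair (m k : ℕ) (x : Fin m) :
    (skipPair m k x).val = if x.val < k then x.val else x.val + 2 := by
  unfold skipPair
  split_ifs <;> rfl

theorem skipPair_injective (m k : ℕ) : Function.Injective (skipPair m k) := by
  intro x y h
  have h' := congrArg Fin.val h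
  rw [val_skipPair, val_skipPair] at h'
  ext
  split_ifs at h' <;> omega

theorem skipPair_surj {m k : ℕ} (hk : k ≤ m) (y : Fin (m + 2)) (h1 : y.val ≠ k)
    (h2 : y.val ≠ k + 1) : ∃ x, skipPair m k x = y := by
  by_cases h : y.val < k
  · refine ⟨⟨y.val, by omega⟩, ?_⟩
    ext
    simp [val_skipPair, h]
  · refine ⟨⟨y.val - 2, by omega⟩, ?_⟩
    ext
    rw [val_skipPair]
    dsimp only
    split_ifs <;> omega

theorem insertPair_skipPair {m k : ℕ} (hk : k ≤ m) (M : Fin m → Fin m) (x : Fin m) :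
    insertPair m k hk M (skipPair m k x) = skipPair m k (M x) := by
  by_cases h : x.val < k
  · have hx : skipPair m k x = ⟨x.val, by omega⟩ := if_pos h
    have h1 : x.val ≠ k := by omega
    have h2 : x.val ≠ k + 1 := by omega
    rw [hx]
    ext
    rw [val_skipPair]
    simp only [insertPair, h, h1, h2, dite_true, dite_false]
    split_ifs <;> rfl
  · have hx : skipPair m k x = ⟨x.val + 2, by omega⟩ := if_neg h
    have h1 : x.val + 2 ≠ k := by omega
    have h2 : x.val + 2 ≠ k + 1 := by omega
    have h3 : ¬ x.val + 2 < k := by omega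
    rw [hx]
    ext
    rw [val_skipPair]
    simp only [insertPair, h1, h2, h3, dite_false, Nat.add_sub_cancel]
    split_ifs <;> rfl

theorem val_finRotate (n : ℕ) (x : Fin (n + 1)) :
    (finRotate (n + 1) x).val = if x.val = n then 0 else x.val + 1 := by
  rw [coe_finRotate]
  simp [Fin.ext_iff]

open Equiv in
/-- Gluing along an inserted adjacent pair adds exactly one vertex class. -/
theorem card_vertexClasses_insertPair (n k : ℕ) (hk : k ≤ n + 1) (M : Fin (n + 1) → Fin (n + 1))
    (hM : Function.Involutive M) (hM' : Function.Involutive (insertPair (n + 1) k hk M))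
    (τ : Perm (Fin (n + 1))) (hτ : τ = (hM.toPerm M).trans (finRotate (n + 1)))
    (τ' : Perm (Fin (n + 1 + 2)))
    (hτ' : τ' = (hM'.toPerm (insertPair (n + 1) k hk M)).trans (finRotate (n + 1 + 2))) :
    (Finset.univ.filter fun y => τ' y = y).card + τ'.cycleType.card
      = (Finset.univ.filter fun y => τ y = y).card + τ.cycleType.card + 1 := by
  classical
  let a : Fin (n + 1 + 2) := ⟨k, by omega⟩
  let b : Fin (n + 1 + 2) := ⟨k + 1, by omega⟩
  have τ_apply (x) : τ x = finRotate (n + 1) (M x) := by simp [hτ]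
  have τ'_apply (y) : τ' y = finRotate (n + 1 + 2) (insertPair (n + 1) k hk M y) := by simp [hτ']
  have ha : (τ' a).val = if k = n + 1 then 0 else k + 2 := by
    rw [τ'_apply, val_finRotate]
    simp [insertPair, a]
  have hb : τ' b = b := by
    ext
    rw [τ'_apply, val_finRotate]
    simp only [insertPair, b]
    split_ifs <;> simp_all <;> omega
  have hane : τ' a ≠ a := by
    intro h
    have := congrArg Fin.val h
    rw [ha] at this
    simp only [a] at this
    split_ifs at this <;> omega
  have hskip (x) : (τ' (skipPair (n + 1) k x)).val
      = if (skipPair (n + 1) k (M x)).val = n + 2 then 0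
        else (skipPair (n + 1) k (M x)).val + 1 := by
    rw [τ'_apply, insertPair_skipPair, val_finRotate]
  let f := Equiv.ofInjective _ (skipPair_injective (n + 1) k)
  have not_range (y : Fin (n + 1 + 2)) (hy : y = a ∨ y = b) :
      y ∉ Set.range (skipPair (n + 1) k) := by
    rintro ⟨x, rfl⟩
    simp only [Fin.ext_iff, val_skipPair, a, b] at hy
    split_ifs at hy <;> omega
  have hext : swap a (τ' a) * τ' = τ.extendDomain f := by
    ext y : 1
    rw [Perm.mul_apply]
    by_cases hya : y = a
    · rw [Perm.extendDomain_apply_not_subtype _ _ (not_range y (Or.inl hya)), hya,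
        swap_apply_right]
    by_cases hyb : y = b
    · rw [Perm.extendDomain_apply_not_subtype _ _ (not_range y (Or.inr hyb)), hyb, hb]
      refine swap_apply_of_ne_of_ne (fun h => ?_) (fun h => ?_)
      · simp [a, b] at h
      · exact hya (hyb.trans (τ'.injective (hb.trans h)))
    obtain ⟨x, rfl⟩ := skipPair_surj hk y (fun h => hya (Fin.ext h)) (fun h => hyb (Fin.ext h))
    have hσ : τ.extendDomain f (skipPair (n + 1) k x) = skipPair (n + 1) k (τ x) :=
      Perm.extendDomain_apply_image τ f x
    rw [hσ]
    have hy := hskip x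
    rw [val_skipPair] at hy
    have hτx : (skipPair (n + 1) k (τ x)).val = _ := val_skipPair _ _ _
    rw [τ_apply, val_finRotate] at hτx
    have hlt := (M x).isLt
    by_cases h : τ' (skipPair (n + 1) k x) = a
    · rw [h, swap_apply_left]
      rw [h] at hy
      ext
      rw [ha, τ_apply, hτx]
      simp only [a] at hy
      split_ifs at hy ⊢ <;> omega
    · rw [swap_apply_of_ne_of_ne h (fun h' => hya (τ'.injective h'))]
      have h' : (τ' (skipPair (n + 1) k x)).val ≠ k := fun e => h (Fin.ext e)
      ext
      rw [τ_apply, hτx]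
      split_ifs at hy ⊢ <;> omega
  have h1 := card_fixed_add_card_cycleType_swap_mul τ' a hane
  have h2 := card_fixed_add_card_cycleType_extendDomain τ f
  rw [hext] at h1
  simp only [Fintype.card_fin] at h2
  omega

/-- A virtual mosaic injection (inserting adjacent matched pairs of
boundary points into the boundary identification) does not change the genus of the
glued surface. -/
theorem stmt_13 (m k : ℕ) (hk : k ≤ m) (M : Fin m → Fin m)
    (hM : Function.Involutive M) (hfix : ∀ x, M x ≠ x)
    (hM' : Function.Involutive (insertPair m k hk M)) :
    matchingGenus (m + 2) (insertPair m k hk M) hM' = matchingGenus m M hM := by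
  cases m with
  | zero =>
    unfold matchingGenus
    dsimp only
    have : k = 0 := by omega
    subst this
    have h : (hM'.toPerm (insertPair 0 0 hk M)).trans (finRotate 2) = 1 := by
      ext y
      fin_cases y <;> simp [insertPair]
    have h₀ : (hM.toPerm M).trans (finRotate 0) = 1 := Subsingleton.elim _ _
    rw [h, h₀]
    simp
  | succ n =>
    have h := card_vertexClasses_insertPair n k hk M hM hM' _ rfl _ rfl
    unfold matchingGenus
    dsimp only
    rw [h]
    omega
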